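/- arXiv:2508.07222 — 7 statements merged into one kernel-verified Lean document; each statement's English description precedes it below -/
import Mathlib

section
/- Let n, m be positive integers, K : (Fin n → ℝ) → Matrix (Fin m) (Fin m) ℝ be differentiable at x₀ with K(x₀) invertible, and u : (Fin n → ℝ) → (Fin m → ℝ) be differentiable at x₀. Define the equivalent static load f_eq(x) := K(x) *ᵥ u(x) and the F-ESL approximate displacement ũ(x) := (K(x))⁻¹ *ᵥ (f_eq(x₀) + (fderiv ℝ f_eq x₀) (x − x₀)). Then ũ(x₀) = u(x₀) and fderiv ℝ ũ x₀ = fderiv ℝ u x₀; that is, the first-order equivalent static load formulation reproduces both the dynamic displacements and their design sensitivities at the linearization point. -/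
open scoped Matrix

attribute [local instance] Matrix.normedAddCommGroup Matrix.normedSpace

open Filter Topology

/-- The product of a function continuous at `x₀` with a function vanishing to first order at `x₀`
has derivative zero there. -/
theorem ContinuousAt.hasFDerivAt_mul_zero {E : Type*} [NormedAddCommGroup E] [NormedSpace ℝ E]
    {a h : E → ℝ} {x₀ : E} (ha : ContinuousAt a x₀) (h₀ : h x₀ = 0)
    (hh : HasFDerivAt h (0 : E →L[ℝ] ℝ) x₀) :
    HasFDerivAt (fun x => a x * h x) (0 : E →L[ℝ] ℝ) x₀ := by
  rw [hasFDerivAt_iff_isLittleO] at hh ⊢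
  have key := (ha.isBigO_one ℝ).mul_isLittleO hh.norm_right
  simpa [h₀] using key

/-- The matrix-vector product of a matrix-valued function continuous at `x₀` with a vector-valued
function vanishing to first order at `x₀` has derivative zero there. -/
theorem ContinuousAt.hasFDerivAt_mulVec_zero {E ι κ : Type*} [NormedAddCommGroup E]
    [NormedSpace ℝ E] [Fintype ι] [Fintype κ] {A : E → Matrix ι κ ℝ} {h : E → κ → ℝ} {x₀ : E}
    (hA : ContinuousAt A x₀) (h₀ : h x₀ = 0) (hh : HasFDerivAt h (0 : E →L[ℝ] κ → ℝ) x₀) :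
    HasFDerivAt (fun x => A x *ᵥ h x) (0 : E →L[ℝ] ι → ℝ) x₀ := by
  rw [hasFDerivAt_pi']
  intro i
  have hterm : ∀ j ∈ Finset.univ,
      HasFDerivAt (fun x => A x i j * h x j) (0 : E →L[ℝ] ℝ) x₀ := fun j _ =>
    ((continuous_apply_apply i j).continuousAt.comp hA).hasFDerivAt_mul_zero (congrFun h₀ j)
      (by simpa using hasFDerivAt_pi'.1 hh j)
  simpa [Matrix.mulVec, dotProduct] using HasFDerivAt.fun_sum hterm

theorem DifferentiableAt.matrix_mulVec {E ι κ : Type*} [NormedAddCommGroup E]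
    [NormedSpace ℝ E] [Fintype ι] [Fintype κ] {A : E → Matrix ι κ ℝ} {v : E → κ → ℝ} {x₀ : E}
    (hA : DifferentiableAt ℝ A x₀) (hv : DifferentiableAt ℝ v x₀) :
    DifferentiableAt ℝ (fun x => A x *ᵥ v x) x₀ := by
  rw [differentiableAt_pi]
  intro i
  have hAi : DifferentiableAt ℝ (fun x => A x i) x₀ := differentiableAt_pi.1 hA i
  exact DifferentiableAt.fun_sum fun j _ =>
    (differentiableAt_pi.1 hAi j).mul (differentiableAt_pi.1 hv j)

/-- The F-ESL approximate displacement reproduces both the dynamic displacements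
and their design sensitivities at the linearization point. -/
theorem fesl_value_and_sensitivity (n m : ℕ) (hn : 0 < n) (hm : 0 < m)
    (K : (Fin n → ℝ) → Matrix (Fin m) (Fin m) ℝ)
    (u : (Fin n → ℝ) → (Fin m → ℝ)) (x₀ : Fin n → ℝ)
    (hK : DifferentiableAt ℝ K x₀) (hKinv : IsUnit (K x₀).det)
    (hu : DifferentiableAt ℝ u x₀)
    (f_eq : (Fin n → ℝ) → (Fin m → ℝ))
    (hf : f_eq = fun x => K x *ᵥ u x)
    (ut : (Fin n → ℝ) → (Fin m → ℝ))
    (hut : ut = fun x => (K x)⁻¹ *ᵥ (f_eq x₀ + (fderiv ℝ f_eq x₀) (x - x₀))) :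
    ut x₀ = u x₀ ∧ fderiv ℝ ut x₀ = fderiv ℝ u x₀ := by
  subst hut
  have hf_diff : DifferentiableAt ℝ f_eq x₀ := hf ▸ hK.matrix_mulVec hu
  have hf_apply (x) : f_eq x = K x *ᵥ u x := by rw [hf]
  have hinv_mulVec {x} (hx : IsUnit (K x).det) : (K x)⁻¹ *ᵥ f_eq x = u x := by
    rw [hf_apply, Matrix.mulVec_mulVec, Matrix.nonsing_inv_mul _ hx, Matrix.one_mulVec]
  refine ⟨by simpa using hinv_mulVec hKinv, ?_⟩
  have hK_inv_cont : ContinuousAt (fun x => (K x)⁻¹) x₀ := by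
    refine ContinuousAt.comp (g := Inv.inv) (continuousAt_matrix_inv _ ?_) hK.continuousAt
    exact NormedRing.inverse_continuousAt hKinv.unit
  have hdet : ∀ᶠ x in 𝓝 x₀, IsUnit (K x).det := by
    have hc : ContinuousAt (fun x => (K x).det) x₀ :=
      (continuous_id.matrix_det).continuousAt.comp hK.continuousAt
    exact (hc.eventually_ne hKinv.ne_zero).mono fun x hx => hx.isUnit
  have hrem : HasFDerivAt (fun x => f_eq x₀ + fderiv ℝ f_eq x₀ (x - x₀) - f_eq x)
      (0 : (Fin n → ℝ) →L[ℝ] Fin m → ℝ) x₀ := by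
    have hlin : HasFDerivAt (fun x => f_eq x₀ + fderiv ℝ f_eq x₀ (x - x₀))
        (fderiv ℝ f_eq x₀) x₀ := by
      simpa using ((fderiv ℝ f_eq x₀).hasFDerivAt.comp (f := fun x => x - x₀) x₀
        ((hasFDerivAt_id x₀).sub_const x₀)).const_add (f_eq x₀)
    simpa using hlin.fun_sub hf_diff.hasFDerivAt
  have hsum := hu.hasFDerivAt.fun_add (hK_inv_cont.hasFDerivAt_mulVec_zero (by simp) hrem)
  rw [add_zero] at hsum
  refine (hsum.congr_of_eventuallyEq ?_).fderiv
  filter_upwards [hdet] with x hx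
  rw [Matrix.mulVec_sub, hinv_mulVec hx, add_sub_cancel]
end

section
/- Let n, m be positive integers, K : (Fin n → ℝ) → Matrix (Fin m) (Fin m) ℝ be differentiable at x₀ with K(x₀) invertible, and u : (Fin n → ℝ) → (Fin m → ℝ) be differentiable at x₀. Define f_eq(x) := K(x) *ᵥ u(x) and the (zeroth-order) ESL approximate displacement ũ(x) := (K(x))⁻¹ *ᵥ f_eq(x₀). Then ũ is differentiable at x₀ and for every direction v ∈ ℝⁿ, (fderiv ℝ ũ x₀) v = (fderiv ℝ u x₀) v − (K(x₀))⁻¹ *ᵥ ((fderiv ℝ f_eq x₀) v); that is, at the linearization point the ESL displacement sensitivities differ from the dynamic ones exactly by the term K(x₀)⁻¹ ∇f_eq(x₀). -/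
open scoped Matrix

attribute [local instance] Matrix.normedAddCommGroup Matrix.normedSpace

/-- Ring inversion in a finite-dimensional normed algebra is differentiable at every unit. -/
theorem FiniteDimensional.differentiableAt_ringInverse {R : Type*} [NormedRing R]
    [NormedAlgebra ℝ R] [FiniteDimensional ℝ R] {a : R} (ha : IsUnit a) :
    DifferentiableAt ℝ (Ring.inverse : R → R) a :=
  have : CompleteSpace R := FiniteDimensional.complete ℝ R
  differentiableAt_inverse ha

/-- Matrix inversion is differentiable at every invertible matrix. -/
theorem Matrix.differentiableAt_inv {m : Type*} [Fintype m] [DecidableEq m]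
    {A : Matrix m m ℝ} (hA : IsUnit A.det) :
    DifferentiableAt ℝ (fun B : Matrix m m ℝ => B⁻¹) A := by
  simp_rw [Matrix.nonsing_inv_eq_ringInverse]
  let _ : NormedRing (Matrix m m ℝ) := Matrix.linftyOpNormedRing
  let _ : NormedAlgebra ℝ (Matrix m m ℝ) := Matrix.linftyOpNormedAlgebra
  exact FiniteDimensional.differentiableAt_ringInverse
    ((Matrix.isUnit_iff_isUnit_det A).mpr hA)

/-- The product rule for the action of a matrix on a vector. -/
theorem DifferentiableAt.exists_hasFDerivAt_matrix_mulVec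
    {E : Type*} [NormedAddCommGroup E] [NormedSpace ℝ E]
    {l m : Type*} [Fintype l] [Fintype m] {A : E → Matrix l m ℝ} {w : E → m → ℝ}
    {x : E} (hA : DifferentiableAt ℝ A x) (hw : DifferentiableAt ℝ w x) :
    ∃ L : E →L[ℝ] (l → ℝ), HasFDerivAt (fun y => A y *ᵥ w y) L x ∧
      ∀ v, L v = A x *ᵥ fderiv ℝ w x v + fderiv ℝ A x v *ᵥ w x :=
  ⟨_, (Matrix.mulVecBilin ℝ ℝ : Matrix l m ℝ →ₗ[ℝ] (m → ℝ) →ₗ[ℝ] l → ℝ).toContinuousBilinearMap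
    |>.hasFDerivAt_of_bilinear hA.hasFDerivAt hw.hasFDerivAt, fun _ => rfl⟩

/-- At the linearization point the (zeroth-order) ESL displacement sensitivities differ
from the dynamic ones exactly by the term `K(x₀)⁻¹ ∇f_eq(x₀)`. -/
theorem esl_sensitivity_gap (n m : ℕ) (hn : 0 < n) (hm : 0 < m)
    (K : (Fin n → ℝ) → Matrix (Fin m) (Fin m) ℝ)
    (u : (Fin n → ℝ) → (Fin m → ℝ)) (x₀ : Fin n → ℝ)
    (hK : DifferentiableAt ℝ K x₀) (hKinv : IsUnit (K x₀).det)
    (hu : DifferentiableAt ℝ u x₀)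
    (f_eq : (Fin n → ℝ) → (Fin m → ℝ))
    (hf : f_eq = fun x => K x *ᵥ u x)
    (ut : (Fin n → ℝ) → (Fin m → ℝ))
    (hut : ut = fun x => (K x)⁻¹ *ᵥ f_eq x₀) :
    DifferentiableAt ℝ ut x₀ ∧
      ∀ v : Fin n → ℝ,
        (fderiv ℝ ut x₀) v =
          (fderiv ℝ u x₀) v - (K x₀)⁻¹ *ᵥ ((fderiv ℝ f_eq x₀) v) := by
  have hinv : DifferentiableAt ℝ (fun x => (K x)⁻¹) x₀ :=
    (Matrix.differentiableAt_inv hKinv).comp x₀ hK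
  have hut_diff : DifferentiableAt ℝ ut x₀ := by
    obtain ⟨L, hL, -⟩ := DifferentiableAt.exists_hasFDerivAt_matrix_mulVec hinv
      (differentiableAt_const (f_eq x₀))
    exact hut ▸ hL.differentiableAt
  refine ⟨hut_diff, fun v => ?_⟩
  obtain ⟨F, hF, hFv⟩ := DifferentiableAt.exists_hasFDerivAt_matrix_mulVec hK hu
  obtain ⟨G, hG, hGv⟩ := DifferentiableAt.exists_hasFDerivAt_matrix_mulVec hK hut_diff
  have hdet : ∀ᶠ x in nhds x₀, IsUnit (K x).det := by
    have hcont : ContinuousAt (fun x => (K x).det) x₀ :=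
      (continuous_id.matrix_det.continuousAt).comp hK.continuousAt
    simpa only [isUnit_iff_ne_zero] using hcont.eventually_ne hKinv.ne_zero
  have hconst : (fun x => K x *ᵥ ut x) =ᶠ[nhds x₀] fun _ => f_eq x₀ := by
    filter_upwards [hdet] with x hx
    rw [hut, Matrix.mulVec_mulVec, Matrix.mul_nonsing_inv _ hx, Matrix.one_mulVec]
  have hG_zero : G = 0 := (hG.congr_of_eventuallyEq hconst.symm).unique
    (hasFDerivAt_const (f_eq x₀) x₀)
  have hut_x₀ : ut x₀ = u x₀ := by
    simp only [hut, hf]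
    rw [Matrix.mulVec_mulVec, Matrix.nonsing_inv_mul _ hKinv, Matrix.one_mulVec]
  have hF_eq : fderiv ℝ f_eq x₀ v = K x₀ *ᵥ (fderiv ℝ u x₀ v - fderiv ℝ ut x₀ v) := by
    have hsum := hGv v
    rw [hG_zero, hut_x₀, zero_apply] at hsum
    rw [hf, hF.fderiv, hFv, Matrix.mulVec_sub, eq_neg_of_add_eq_zero_right hsum.symm,
      sub_eq_add_neg]
  rw [hF_eq, Matrix.mulVec_mulVec, Matrix.nonsing_inv_mul _ hKinv, Matrix.one_mulVec,
    sub_sub_cancel]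
end

section
/- Let n, m be positive integers, K : (Fin n → ℝ) → Matrix (Fin m) (Fin m) ℝ be differentiable at x₀ with K(x₀) invertible, and u : (Fin n → ℝ) → (Fin m → ℝ) be differentiable at x₀. Define f_eq(x) := K(x) *ᵥ u(x) and ũ(x) := (K(x))⁻¹ *ᵥ f_eq(x₀). Then fderiv ℝ ũ x₀ = fderiv ℝ u x₀ if and only if fderiv ℝ f_eq x₀ = 0; that is, the zeroth-order ESL displacement sensitivities coincide with the dynamic ones at the linearization point exactly when the gradient of the equivalent static loads vanishes there. -/
open scoped Matrix

attribute [local instance] Matrix.normedAddCommGroup Matrix.normedSpace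

namespace Matrix

variable {E m p : Type*} [NormedAddCommGroup E] [NormedSpace ℝ E] [Fintype p]
  {A : E → Matrix m p ℝ} {v : E → p → ℝ} {M : E → Matrix m m ℝ} {x : E}

theorem differentiableAt_iff_apply :
    DifferentiableAt ℝ A x ↔ ∀ i j, DifferentiableAt ℝ (fun y => A y i j) x := by
  have h := differentiableAt_pi (𝕜 := ℝ) (Φ := fun y i => A y i) (x := x)
  refine Iff.trans h (forall_congr' fun i => ?_)
  exact differentiableAt_pi

variable [Fintype m]

theorem fderiv_mulVec_apply (hA : DifferentiableAt ℝ A x) (hv : DifferentiableAt ℝ v x) (d : E) :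
    fderiv ℝ (fun y => A y *ᵥ v y) x d = fderiv ℝ A x d *ᵥ v x + A x *ᵥ fderiv ℝ v x d := by
  have h := (mulVecBilin ℝ ℝ : Matrix m p ℝ →ₗ[ℝ] _).toContinuousBilinearMap.hasFDerivAt_of_bilinear
    hA.hasFDerivAt hv.hasFDerivAt
  have h' : HasFDerivAt (fun y => A y *ᵥ v y) _ x := h
  rw [h'.fderiv]
  exact add_comm _ _

theorem _root_.DifferentiableAt.matrix_mulVec_s2 (hA : DifferentiableAt ℝ A x)
    (hv : DifferentiableAt ℝ v x) : DifferentiableAt ℝ (fun y => A y *ᵥ v y) x :=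
  ((mulVecBilin ℝ ℝ : Matrix m p ℝ →ₗ[ℝ] _).toContinuousBilinearMap.hasFDerivAt_of_bilinear
    hA.hasFDerivAt hv.hasFDerivAt).differentiableAt

variable [DecidableEq m]

theorem _root_.DifferentiableAt.matrix_det (hM : DifferentiableAt ℝ M x) :
    DifferentiableAt ℝ (fun y => (M y).det) x := by
  rw [differentiableAt_iff_apply] at hM
  simp only [det_apply']
  fun_prop

theorem _root_.DifferentiableAt.matrix_adjugate (hM : DifferentiableAt ℝ M x) :
    DifferentiableAt ℝ (fun y => (M y).adjugate) x := by
  rw [differentiableAt_iff_apply] at hM ⊢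
  intro i j
  simp only [adjugate_apply]
  refine DifferentiableAt.matrix_det (differentiableAt_iff_apply.2 fun k l => ?_)
  by_cases hk : k = j
  · simp [updateRow_apply, hk]
  · simpa [updateRow_apply, hk] using hM k l

theorem _root_.DifferentiableAt.matrix_inv (hM : DifferentiableAt ℝ M x)
    (hx : IsUnit (M x).det) : DifferentiableAt ℝ (fun y => (M y)⁻¹) x := by
  simp only [inv_def, Ring.inverse_eq_inv']
  exact (hM.matrix_det.fun_inv hx.ne_zero).fun_smul hM.matrix_adjugate

end Matrix

/-- The zeroth-order ESL displacement sensitivities coincide with the dynamic ones at the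
linearization point exactly when the gradient of the equivalent static loads vanishes there. -/
theorem esl_sensitivity_iff_grad_feq_zero (n m : ℕ) (hn : 0 < n) (hm : 0 < m)
    (K : (Fin n → ℝ) → Matrix (Fin m) (Fin m) ℝ)
    (u : (Fin n → ℝ) → (Fin m → ℝ)) (x₀ : Fin n → ℝ)
    (hK : DifferentiableAt ℝ K x₀) (hKinv : IsUnit (K x₀).det)
    (hu : DifferentiableAt ℝ u x₀)
    (f_eq : (Fin n → ℝ) → (Fin m → ℝ))
    (hf : f_eq = fun x => K x *ᵥ u x)
    (ut : (Fin n → ℝ) → (Fin m → ℝ))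
    (hut : ut = fun x => (K x)⁻¹ *ᵥ f_eq x₀) :
    fderiv ℝ ut x₀ = fderiv ℝ u x₀ ↔ fderiv ℝ f_eq x₀ = 0 := by
  have hutd : DifferentiableAt ℝ ut x₀ := by
    rw [hut]
    exact (hK.matrix_inv hKinv).matrix_mulVec_s2 (differentiableAt_const _)
  have hut₀ : ut x₀ = u x₀ := by
    simp [hut, hf, Matrix.mulVec_mulVec, Matrix.nonsing_inv_mul _ hKinv]
  have hconst : (fun x => K x *ᵥ ut x) =ᶠ[nhds x₀] fun _ => f_eq x₀ := by
    filter_upwards [hK.matrix_det.continuousAt.eventually_ne hKinv.ne_zero] with x hx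
    rw [hut]
    simp [Matrix.mulVec_mulVec, Matrix.mul_nonsing_inv _ (isUnit_iff_ne_zero.2 hx)]
  have hzero (d) : fderiv ℝ K x₀ d *ᵥ u x₀ + K x₀ *ᵥ fderiv ℝ ut x₀ d = 0 := by
    rw [← hut₀, ← Matrix.fderiv_mulVec_apply hK hutd, hconst.fderiv_eq]
    simp
  have hfeq (d) : fderiv ℝ f_eq x₀ d = K x₀ *ᵥ fderiv ℝ u x₀ d - K x₀ *ᵥ fderiv ℝ ut x₀ d := by
    rw [hf, Matrix.fderiv_mulVec_apply hK hu, eq_neg_of_add_eq_zero_left (hzero d)]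
    abel
  have hinj : Function.Injective (K x₀).mulVec :=
    Matrix.mulVec_injective_of_isUnit ((Matrix.isUnit_iff_isUnit_det _).2 hKinv)
  rw [eq_comm]
  simp only [ContinuousLinearMap.ext_iff, hfeq, zero_apply, sub_eq_zero, hinj.eq_iff]
end

section
/- Let n, m be positive integers and J a natural number. Let u, ũ : (Fin n → ℝ) → (Fin m → ℝ) be differentiable at x* with ũ(x*) = u(x*) and fderiv ℝ ũ x* = fderiv ℝ u x*. Let f_c : (Fin n → ℝ) × (Fin m → ℝ) → ℝ and g : Fin J → ((Fin n → ℝ) × (Fin m → ℝ) → ℝ) be differentiable at (x*, u(x*)), and let λ : Fin J → ℝ. Suppose (x*, λ) satisfies the KKT conditions of the approximate problem: (i) stationarity, fderiv ℝ (fun x => f_c(x, ũ(x)) + ∑ j, λ j * (g j)(x, ũ(x))) x* = 0; (ii) primal feasibility, (g j)(x*, ũ(x*)) ≤ 0 for all j; (iii) dual feasibility, λ j ≥ 0 for all j; (iv) complementarity, λ j * (g j)(x*, ũ(x*)) = 0 for all j. Then (x*, λ) satisfies the same four KKT conditions with u in place of ũ, i.e. it is a KKT point of the original problem. -/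
/-- The derivative of `x ↦ L (x, v x)` depends on `v` only through its value and derivative. -/
theorem fderiv_comp_graph_congr {E F G : Type*} [NormedAddCommGroup E] [NormedSpace ℝ E]
    [NormedAddCommGroup F] [NormedSpace ℝ F] [NormedAddCommGroup G] [NormedSpace ℝ G]
    {v w : E → F} {x : E} {L : E × F → G}
    (hv : DifferentiableAt ℝ v x) (hw : DifferentiableAt ℝ w x)
    (hval : v x = w x) (hder : fderiv ℝ v x = fderiv ℝ w x)
    (hL : DifferentiableAt ℝ L (x, w x)) :
    fderiv ℝ (fun y => L (y, v y)) x = fderiv ℝ (fun y => L (y, w y)) x := by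
  have hLv : HasFDerivAt L (fderiv ℝ L (x, w x)) (x, v x) := hval ▸ hL.hasFDerivAt
  have h₁ := hLv.comp x ((hasFDerivAt_id x).prodMk hv.hasFDerivAt)
  have h₂ := hL.hasFDerivAt.comp x ((hasFDerivAt_id x).prodMk hw.hasFDerivAt)
  rw [hder] at h₁
  exact h₁.fderiv.trans h₂.fderiv.symm


/-- If the approximate displacements match the dynamic displacements in value and
sensitivity at `xs`, then any KKT point of the approximate problem is a KKT point of
the original problem, with the same Lagrange multipliers. -/
theorem kkt_transfer (n m : ℕ) (hn : 0 < n) (hm : 0 < m) (J : ℕ)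
    (u ut : (Fin n → ℝ) → (Fin m → ℝ)) (xs : Fin n → ℝ)
    (hu : DifferentiableAt ℝ u xs) (hut : DifferentiableAt ℝ ut xs)
    (hval : ut xs = u xs) (hder : fderiv ℝ ut xs = fderiv ℝ u xs)
    (f_c : (Fin n → ℝ) × (Fin m → ℝ) → ℝ)
    (g : Fin J → ((Fin n → ℝ) × (Fin m → ℝ) → ℝ))
    (hf : DifferentiableAt ℝ f_c (xs, u xs))
    (hg : ∀ j, DifferentiableAt ℝ (g j) (xs, u xs))
    (lam : Fin J → ℝ)
    (hstat : fderiv ℝ (fun x => f_c (x, ut x) + ∑ j, lam j * (g j) (x, ut x)) xs = 0)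
    (hprimal : ∀ j, (g j) (xs, ut xs) ≤ 0)
    (hdual : ∀ j, 0 ≤ lam j)
    (hcompl : ∀ j, lam j * (g j) (xs, ut xs) = 0) :
    fderiv ℝ (fun x => f_c (x, u x) + ∑ j, lam j * (g j) (x, u x)) xs = 0 ∧
      (∀ j, (g j) (xs, u xs) ≤ 0) ∧
      (∀ j, 0 ≤ lam j) ∧
      (∀ j, lam j * (g j) (xs, u xs) = 0) := by
  have hL : DifferentiableAt ℝ (fun p => f_c p + ∑ j, lam j * g j p) (xs, u xs) :=
    hf.add (DifferentiableAt.fun_sum fun j _ => (hg j).const_mul (lam j))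
  refine ⟨?_, fun j => hval ▸ hprimal j, hdual, fun j => hval ▸ hcompl j⟩
  exact (fderiv_comp_graph_congr hut hu hval hder hL).symm.trans hstat
end

section
/- Let n, m be positive integers, K : (Fin n → ℝ) → Matrix (Fin m) (Fin m) ℝ be differentiable at x₀ with K(x₀) invertible, and u : (Fin n → ℝ) → (Fin m → ℝ) be differentiable at x₀. Define f_eq(x) := K(x) *ᵥ u(x) and the ESL displacement ũ(x) := (K(x))⁻¹ *ᵥ f_eq(x₀). Let F : (Fin n → ℝ) × (Fin m → ℝ) → ℝ be differentiable at (x₀, u(x₀)). Then the difference of the Fréchet derivatives at x₀ of x ↦ F(x, u(x)) and x ↦ F(x, ũ(x)) is the linear map v ↦ D₂F(x₀, u(x₀)) ((K(x₀))⁻¹ *ᵥ ((fderiv ℝ f_eq x₀) v)), where D₂F denotes the partial Fréchet derivative of F with respect to its second (displacement) argument. In particular, the gradients of any displacement-dependent objective or constraint evaluated through ESL differ from the true gradients by this correction term. -/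
open scoped Matrix

attribute [local instance] Matrix.normedAddCommGroup Matrix.normedSpace

section EntrywiseCalculus

variable {E ι : Type*} [NormedAddCommGroup E] [NormedSpace ℝ E] [Fintype ι]

theorem Matrix.differentiableAt_det_of_entries [DecidableEq ι] {A : E → Matrix ι ι ℝ} {x : E}
    (hA : ∀ i j, DifferentiableAt ℝ (fun y => A y i j) x) :
    DifferentiableAt ℝ (fun y => (A y).det) x := by
  simp only [Matrix.det_apply']
  exact DifferentiableAt.fun_sum fun σ _ =>
    (HasFDerivAt.finsetProd fun i _ => (hA (σ i) i).hasFDerivAt).differentiableAt.const_mul _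

theorem Matrix.differentiableAt_inv_entry [DecidableEq ι] {A : E → Matrix ι ι ℝ} {x : E}
    (hA : ∀ i j, DifferentiableAt ℝ (fun y => A y i j) x) (hx : (A x).det ≠ 0) (i j : ι) :
    DifferentiableAt ℝ (fun y => (A y)⁻¹ i j) x := by
  simp only [Matrix.inv_def, Ring.inverse_eq_inv', Matrix.smul_apply, smul_eq_mul,
    Matrix.adjugate_apply]
  refine ((Matrix.differentiableAt_det_of_entries hA).inv hx).mul
    (Matrix.differentiableAt_det_of_entries fun k l => ?_)
  by_cases h : k = j
  · subst h
    simp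
  · simpa [Matrix.updateRow_ne h] using hA k l

theorem Matrix.hasFDerivAt_mulVec_of_eq_zero {A : E → Matrix ι ι ℝ} {w : E → ι → ℝ} {x : E}
    {w' : E →L[ℝ] ι → ℝ} (hA : ∀ i j, DifferentiableAt ℝ (fun y => A y i j) x)
    (hw : HasFDerivAt w w' x) (hx : w x = 0) :
    HasFDerivAt (fun y => A y *ᵥ w y) ((A x).mulVecLin.toContinuousLinearMap.comp w') x := by
  rw [hasFDerivAt_pi']
  intro i
  have h := HasFDerivAt.fun_sum (u := Finset.univ) fun j _ =>
    (hA i j).hasFDerivAt.mul (hasFDerivAt_pi'.1 hw j)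
  refine h.congr_fderiv ?_
  ext v
  simp [hx, Matrix.mulVec, dotProduct]

end EntrywiseCalculus

/-- The gradients of any displacement-dependent function evaluated through the
zeroth-order ESL displacements differ from the true gradients by the correction term
`v ↦ D₂F(x₀, u(x₀)) (K(x₀)⁻¹ *ᵥ ∇f_eq(x₀) v)`. -/
theorem esl_gradient_correction (n m : ℕ) (hn : 0 < n) (hm : 0 < m)
    (K : (Fin n → ℝ) → Matrix (Fin m) (Fin m) ℝ)
    (u : (Fin n → ℝ) → (Fin m → ℝ)) (x₀ : Fin n → ℝ)
    (hK : DifferentiableAt ℝ K x₀) (hKinv : IsUnit (K x₀).det)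
    (hu : DifferentiableAt ℝ u x₀)
    (f_eq : (Fin n → ℝ) → (Fin m → ℝ))
    (hf : f_eq = fun x => K x *ᵥ u x)
    (ut : (Fin n → ℝ) → (Fin m → ℝ))
    (hut : ut = fun x => (K x)⁻¹ *ᵥ f_eq x₀)
    (F : (Fin n → ℝ) × (Fin m → ℝ) → ℝ)
    (hF : DifferentiableAt ℝ F (x₀, u x₀)) :
    ∀ v : Fin n → ℝ,
      fderiv ℝ (fun x => F (x, u x)) x₀ v - fderiv ℝ (fun x => F (x, ut x)) x₀ v =
        fderiv ℝ (fun w => F (x₀, w)) (u x₀) ((K x₀)⁻¹ *ᵥ ((fderiv ℝ f_eq x₀) v)) := by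
  have hKe : ∀ i j, DifferentiableAt ℝ (fun x => K x i j) x₀ := fun i j =>
    differentiableAt_pi.1 (differentiableAt_pi.1 hK i) j
  have hdet : (K x₀).det ≠ 0 := hKinv.ne_zero
  have hut_diff : DifferentiableAt ℝ ut x₀ := by
    rw [hut, differentiableAt_pi]
    intro i
    simp only [Matrix.mulVec, dotProduct]
    exact DifferentiableAt.fun_sum fun j _ =>
      (Matrix.differentiableAt_inv_entry hKe hdet i j).mul_const _
  have hut₀ : ut x₀ = u x₀ := by
    simp [hut, hf, Matrix.mulVec_mulVec, Matrix.nonsing_inv_mul _ hKinv]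
  have hw := hu.hasFDerivAt.sub hut_diff.hasFDerivAt
  have hKw := Matrix.hasFDerivAt_mulVec_of_eq_zero hKe hw (by simp [hut₀])
  have hev : f_eq =ᶠ[nhds x₀] fun x => K x *ᵥ (u - ut) x + f_eq x₀ := by
    filter_upwards [(Matrix.differentiableAt_det_of_entries hKe).continuousAt.eventually_ne hdet]
      with x hx
    have hKut : K x *ᵥ ut x = f_eq x₀ := by
      simp [hut, Matrix.mulVec_mulVec, Matrix.mul_nonsing_inv _ hx.isUnit]
    rw [Pi.sub_apply, Matrix.mulVec_sub, hKut, hf]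
    simp
  have hfd := ((hKw.add_const (f_eq x₀)).congr_of_eventuallyEq hev).fderiv
  have hFu := (hF.hasFDerivAt.comp x₀ ((hasFDerivAt_id x₀).prodMk hu.hasFDerivAt)).fderiv
  have hFut := (HasFDerivAt.comp (g := F) x₀ (by simpa [hut₀] using hF.hasFDerivAt)
    ((hasFDerivAt_id x₀).prodMk hut_diff.hasFDerivAt)).fderiv
  have hF₂ := (hF.hasFDerivAt.comp (u x₀)
    ((hasFDerivAt_const x₀ (u x₀)).prodMk (hasFDerivAt_id (u x₀)))).fderiv
  simp only [Function.comp_def, id] at hFu hFut hF₂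
  intro v
  rw [hFu, hFut, hF₂, hfd]
  simp [Matrix.mulVec_sub, Matrix.mulVec_mulVec, Matrix.nonsing_inv_mul _ hKinv, ← map_sub]
end

section
/- Let n, m be positive integers, K : (Fin n → ℝ) → Matrix (Fin m) (Fin m) ℝ, u : (Fin n → ℝ) → (Fin m → ℝ), and let x₀, x ∈ ℝⁿ be such that K is differentiable at both x₀ and x, with both K(x₀) and K(x) invertible, and u is differentiable at x₀. Define f_eq(y) := K(y) *ᵥ u(y) and the F-ESL displacement ũ(y) := (K(y))⁻¹ *ᵥ (f_eq(x₀) + (fderiv ℝ f_eq x₀) (y − x₀)). Then for every direction v ∈ ℝⁿ, (fderiv ℝ ũ x) v = ((fderiv ℝ (fun y => (K y)⁻¹) x) v + (K x)⁻¹ * ((fderiv ℝ K x₀) v) * (K x₀)⁻¹) *ᵥ f_eq(x₀) + ((fderiv ℝ (fun y => (K y)⁻¹) x) v) *ᵥ ((fderiv ℝ f_eq x₀) (x − x₀)) + ((K x)⁻¹ * K x₀) *ᵥ ((fderiv ℝ u x₀) v). -/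
open scoped Matrix

attribute [local instance] Matrix.normedAddCommGroup Matrix.normedSpace

/-- The determinant of a matrix with differentiable entries is differentiable. -/
theorem differentiableAt_matrix_det {E : Type*} [NormedAddCommGroup E] [NormedSpace ℝ E] {m : ℕ}
    {A : E → Matrix (Fin m) (Fin m) ℝ} {x : E}
    (hA : ∀ i j, DifferentiableAt ℝ (fun y => A y i j) x) :
    DifferentiableAt ℝ (fun y => (A y).det) x := by
  simp only [Matrix.det_apply']
  refine DifferentiableAt.fun_sum fun σ _ => DifferentiableAt.const_mul ?_ _
  exact (HasFDerivAt.finsetProd fun i _ => (hA _ _).hasFDerivAt).differentiableAt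

/-- The pointwise inverse of a differentiable matrix-valued map is differentiable where the matrix
is invertible. -/
theorem differentiableAt_matrix_inv {E : Type*} [NormedAddCommGroup E] [NormedSpace ℝ E] {m : ℕ}
    {A : E → Matrix (Fin m) (Fin m) ℝ} {x : E} (hA : DifferentiableAt ℝ A x)
    (hdet : IsUnit (A x).det) : DifferentiableAt ℝ (fun y => (A y)⁻¹) x := by
  have hentry : ∀ i j, DifferentiableAt ℝ (fun y => A y i j) x := fun i j =>
    differentiableAt_pi.1 (differentiableAt_pi.1 hA i) j
  refine differentiableAt_pi.2 fun i => differentiableAt_pi.2 fun j => ?_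
  simp only [Matrix.inv_def, Ring.inverse_eq_inv', Matrix.smul_apply, Matrix.adjugate_apply,
    smul_eq_mul]
  refine ((differentiableAt_matrix_det hentry).fun_inv hdet.ne_zero).mul
    (differentiableAt_matrix_det fun k l => ?_)
  by_cases h : k = j
  · subst h
    simp
  · simpa [Matrix.updateRow_ne h] using hentry k l

/-- The product rule for matrix-vector multiplication. -/
theorem fderiv_mulVec_apply {E : Type*} [NormedAddCommGroup E] [NormedSpace ℝ E] {m : ℕ}
    {A : E → Matrix (Fin m) (Fin m) ℝ} {w : E → Fin m → ℝ} {x : E}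
    (hA : DifferentiableAt ℝ A x) (hw : DifferentiableAt ℝ w x) (v : E) :
    fderiv ℝ (fun y => A y *ᵥ w y) x v = A x *ᵥ fderiv ℝ w x v + fderiv ℝ A x v *ᵥ w x := by
  have h := ((Matrix.mulVecBilin ℝ ℝ :
    Matrix (Fin m) (Fin m) ℝ →ₗ[ℝ] _ →ₗ[ℝ] _).toContinuousBilinearMap).hasFDerivAt_of_bilinear
    hA.hasFDerivAt hw.hasFDerivAt
  exact congrArg (fun T => T v) h.fderiv

/-- Sensitivity of the F-ESL approximate displacement at a general design point `x`. -/
theorem fesl_sensitivity_general (n m : ℕ) (hn : 0 < n) (hm : 0 < m)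
    (K : (Fin n → ℝ) → Matrix (Fin m) (Fin m) ℝ)
    (u : (Fin n → ℝ) → (Fin m → ℝ)) (x₀ x : Fin n → ℝ)
    (hK₀ : DifferentiableAt ℝ K x₀) (hKx : DifferentiableAt ℝ K x)
    (hKinv₀ : IsUnit (K x₀).det) (hKinvx : IsUnit (K x).det)
    (hu : DifferentiableAt ℝ u x₀)
    (f_eq : (Fin n → ℝ) → (Fin m → ℝ))
    (hf : f_eq = fun y => K y *ᵥ u y)
    (ut : (Fin n → ℝ) → (Fin m → ℝ))
    (hut : ut = fun y => (K y)⁻¹ *ᵥ (f_eq x₀ + (fderiv ℝ f_eq x₀) (y - x₀))) :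
    ∀ v : Fin n → ℝ,
      (fderiv ℝ ut x) v =
        ((fderiv ℝ (fun y => (K y)⁻¹) x) v
            + (K x)⁻¹ * ((fderiv ℝ K x₀) v) * (K x₀)⁻¹) *ᵥ f_eq x₀
          + ((fderiv ℝ (fun y => (K y)⁻¹) x) v) *ᵥ ((fderiv ℝ f_eq x₀) (x - x₀))
          + ((K x)⁻¹ * K x₀) *ᵥ ((fderiv ℝ u x₀) v) := by
  intro v
  have hlin : HasFDerivAt (fun y => f_eq x₀ + fderiv ℝ f_eq x₀ (y - x₀)) (fderiv ℝ f_eq x₀) x :=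
    ((fderiv ℝ f_eq x₀).hasFDerivAt.comp x ((hasFDerivAt_id x).sub_const x₀)).const_add _
  have hf_deriv : fderiv ℝ f_eq x₀ v = K x₀ *ᵥ fderiv ℝ u x₀ v + fderiv ℝ K x₀ v *ᵥ u x₀ := by
    rw [hf]
    exact fderiv_mulVec_apply hK₀ hu v
  have hu₀ : (K x₀)⁻¹ *ᵥ f_eq x₀ = u x₀ := by
    simp [hf, Matrix.nonsing_inv_mul _ hKinv₀]
  rw [hut, fderiv_mulVec_apply (differentiableAt_matrix_inv hKx hKinvx) hlin.differentiableAt,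
    hlin.fderiv, hf_deriv, Matrix.add_mulVec, ← Matrix.mulVec_mulVec (f_eq x₀), hu₀]
  simp only [Matrix.mulVec_add, Matrix.mulVec_mulVec]
  abel
end

section
/- Let m be a positive integer and let M, K : ℝ → Matrix (Fin m) (Fin m) ℝ be differentiable at t₀ with M(t) and K(t) symmetric for every t. Let ω : ℝ → ℝ and φ : ℝ → (Fin m → ℝ) be differentiable at t₀ and suppose that for all t: K(t) *ᵥ φ(t) = (ω t)^2 • (M(t) *ᵥ φ(t)) (generalized eigenvalue equation) and φ(t) ⬝ᵥ (M(t) *ᵥ φ(t)) = 1 (mass normalization), and that ω(t₀) > 0. Then deriv ω t₀ = (φ(t₀) ⬝ᵥ ((deriv K t₀ - (ω t₀)^2 • deriv M t₀) *ᵥ φ(t₀))) / (2 * ω t₀); that is, the sensitivity of a natural frequency with respect to a design parameter is φ̂ᵀ(∂K/∂x − ω² ∂M/∂x)φ̂ / (2ω) for the mass-normalized eigenvector φ̂. -/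
open scoped Matrix

attribute [local instance] Matrix.normedAddCommGroup Matrix.normedSpace

open Matrix in
/-- Product rule for a matrix-valued function applied to a vector-valued function. -/
theorem HasDerivAt.matrix_mulVec {m n : Type*} [Fintype m] [Fintype n]
    {A : ℝ → Matrix m n ℝ} {A' : Matrix m n ℝ} {v : ℝ → n → ℝ} {v' : n → ℝ} {t : ℝ}
    (hA : HasDerivAt A A' t) (hv : HasDerivAt v v' t) :
    HasDerivAt (fun s => A s *ᵥ v s) (A' *ᵥ v t + A t *ᵥ v') t := by
  have hentry (i : m) (j : n) : HasDerivAt (fun s => A s i j) (A' i j) t :=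
    hasDerivAt_pi.1 (hasDerivAt_pi.1 hA i) j
  refine hasDerivAt_pi.2 fun i => ?_
  have hsum := HasDerivAt.fun_sum (u := Finset.univ)
    fun j _ => (hentry i j).mul (hasDerivAt_pi.1 hv j)
  simpa [mulVec, dotProduct, Finset.sum_add_distrib] using hsum

open Matrix in
/-- If a symmetric matrix function annihilates a vector function near `t`, its derivative has
vanishing quadratic form at the vector. -/
theorem HasDerivAt.dotProduct_mulVec_eq_zero {n : Type*} [Fintype n]
    {A : ℝ → Matrix n n ℝ} {A' : Matrix n n ℝ} {v : ℝ → n → ℝ} {t : ℝ}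
    (hA : HasDerivAt A A' t) (hv : DifferentiableAt ℝ v t) (hsymm : (A t).IsSymm)
    (hker : ∀ s, A s *ᵥ v s = 0) : v t ⬝ᵥ (A' *ᵥ v t) = 0 := by
  have hderiv := hA.matrix_mulVec hv.hasDerivAt
  simp only [hker] at hderiv
  have hzero := hderiv.unique (hasDerivAt_const t 0)
  have hleft : v t ᵥ* A t = 0 := by
    rw [← mulVec_transpose, hsymm.eq, hker]
  have hdot := congrArg (v t ⬝ᵥ ·) hzero
  simpa only [dotProduct_add, dotProduct_mulVec (v t) (A t), hleft, zero_dotProduct, add_zero,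
    dotProduct_zero] using hdot

/-- Sensitivity of a natural frequency with respect to a scalar design parameter:
`dω/dt = φ̂ᵀ(∂K/∂t − ω² ∂M/∂t)φ̂ / (2ω)` for the mass-normalized eigenvector `φ̂`. -/
theorem natural_frequency_sensitivity (m : ℕ) (hm : 0 < m)
    (M K : ℝ → Matrix (Fin m) (Fin m) ℝ) (t₀ : ℝ)
    (hM : DifferentiableAt ℝ M t₀) (hK : DifferentiableAt ℝ K t₀)
    (hMsymm : ∀ t, (M t).IsSymm) (hKsymm : ∀ t, (K t).IsSymm)
    (ω : ℝ → ℝ) (φ : ℝ → (Fin m → ℝ))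
    (hω : DifferentiableAt ℝ ω t₀) (hφ : DifferentiableAt ℝ φ t₀)
    (heig : ∀ t, K t *ᵥ φ t = (ω t) ^ 2 • (M t *ᵥ φ t))
    (hnorm : ∀ t, φ t ⬝ᵥ (M t *ᵥ φ t) = 1)
    (hωpos : 0 < ω t₀) :
    deriv ω t₀ =
      (φ t₀ ⬝ᵥ ((deriv K t₀ - (ω t₀) ^ 2 • deriv M t₀) *ᵥ φ t₀)) / (2 * ω t₀) := by
  have hA : HasDerivAt (fun t => K t - ω t ^ 2 • M t)
      (deriv K t₀ - (ω t₀ ^ 2 • deriv M t₀ + (2 * ω t₀ * deriv ω t₀) • M t₀)) t₀ := by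
    have hω2 : HasDerivAt (fun t => ω t ^ 2) (2 * ω t₀ * deriv ω t₀) t₀ := by
      simpa using hω.hasDerivAt.fun_pow 2
    exact hK.hasDerivAt.fun_sub (hω2.fun_smul hM.hasDerivAt)
  have hquad := hA.dotProduct_mulVec_eq_zero hφ
    ((hKsymm t₀).sub ((hMsymm t₀).smul _)) fun t => by
      simp [Matrix.sub_mulVec, Matrix.smul_mulVec, heig t]
  simp only [Matrix.sub_mulVec, Matrix.add_mulVec, Matrix.smul_mulVec, dotProduct_sub,
    dotProduct_add, dotProduct_smul, hnorm, smul_eq_mul] at hquad ⊢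
  rw [eq_div_iff (by positivity)]
  linarith
end
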